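/- arXiv:1701.03677 — 2 statements merged into one kernel-verified Lean document; each statement's English description precedes it below -/
import Mathlib

section
/- Let m_11, m_12, m_21 be integers with 0 ≤ m_11 ≤ m_21 ≤ m_12, and let I_Z = (x_0,x_2)^{m_11} ∩ (x_0,x_3)^{m_12} ∩ (x_1,x_2)^{m_21}. Then for every (a,b) ∈ ℕ², β_0,(a,b)(I_Z) = (min{a, b − m_11, m_21 − m_11} + 1)_+ + φ_{m_12, m_12 − m_11}(b) if a + b = m_12 + m_21, and β_0,(a,b)(I_Z) = 0 otherwise. -/
open MvPolynomial Module

noncomputable section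

/-- The recursively defined function `φ_t(n)` (natural index). -/
def phiNat : ℕ → ℤ → ℤ
  | 0, _ => 0
  | 1, n => if n = 0 then 1 else 0
  | (t+2), n =>
    if 0 ≤ n ∧ n < (t : ℤ) + 1 then phiNat (t+1) n
    else if (t : ℤ) + 1 ≤ n ∧ n < 2 * ((t : ℤ) + 1) + 1 then phiNat (t+1) n + 1
    else 0

/-- `φ_t : ℤ → ℤ`, identically `0` for `t ≤ 0`. -/
def phi (t n : ℤ) : ℤ := if 0 < t then phiNat t.toNat n else 0

/-- `φ_{t,d}(n) = φ_t(n+d) − φ_d(n+d)`. -/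
def phi2 (t d n : ℤ) : ℤ := phi t (n + d) - phi d (n + d)

/-- `(n)_+ = max{n, 0}`. -/
def pos (n : ℤ) : ℤ := max n 0

variable (k : Type*) [Field k] [CharZero k]

/-- The bigrading weights on `k[x₀,x₁,x₂,x₃]`. -/
def w : Fin 4 → ℕ × ℕ := ![(1,0), (1,0), (0,1), (0,1)]

/-- The bihomogeneous component `R_{(a,b)}` as a `k`-subspace. -/
def comp (a b : ℕ) : Submodule k (MvPolynomial (Fin 4) k) :=
  weightedHomogeneousSubmodule k w (a, b)

/-- The irrelevant ideal `𝔪 = (x₀,x₁,x₂,x₃)`. -/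
def mIdeal : Ideal (MvPolynomial (Fin 4) k) :=
  Ideal.span {X 0, X 1, X 2, X 3}

/-- `β_{0,(a,b)}(I) = dim_k (I ∩ R_{(a,b)}) − dim_k ((𝔪·I) ∩ R_{(a,b)})`. -/
def beta0 (I : Ideal (MvPolynomial (Fin 4) k)) (a b : ℕ) : ℤ :=
  (finrank k ↥(I.restrictScalars k ⊓ comp k a b) : ℤ)
    - (finrank k ↥((mIdeal k * I).restrictScalars k ⊓ comp k a b) : ℤ)

/-- The Hilbert function `H(a,b) = (a+1)(b+1) − dim_k (I ∩ R_{(a,b)})`, `0` off `ℕ²`. -/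
def HF (I : Ideal (MvPolynomial (Fin 4) k)) (a b : ℤ) : ℤ :=
  if 0 ≤ a ∧ 0 ≤ b then
    (a + 1) * (b + 1) - (finrank k ↥(I.restrictScalars k ⊓ comp k a.toNat b.toNat) : ℤ)
  else 0

/-- The first difference `ΔH(a,b)`. -/
def dHF (I : Ideal (MvPolynomial (Fin 4) k)) (a b : ℤ) : ℤ :=
  HF k I a b + HF k I (a-1) (b-1) - HF k I (a-1) b - HF k I a (b-1)

def I11 : Ideal (MvPolynomial (Fin 4) k) := Ideal.span {X 0, X 2}
def I12 : Ideal (MvPolynomial (Fin 4) k) := Ideal.span {X 0, X 3}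
def I21 : Ideal (MvPolynomial (Fin 4) k) := Ideal.span {X 1, X 2}

/-- The ideal of `Z = m₁₁P₁₁ + m₁₂P₁₂ + m₂₁P₂₁`. -/
def IZ (m11 m12 m21 : ℕ) : Ideal (MvPolynomial (Fin 4) k) :=
  I11 k ^ m11 ⊓ I12 k ^ m12 ⊓ I21 k ^ m21

/-- `max{m₁₁, m₁₂ + m₂₁}`. -/
def Dbound (m11 m12 m21 : ℕ) : ℤ := max (m11 : ℤ) ((m12 : ℤ) + m21)

def D1set (m11 m12 m21 : ℕ) : Set (ℕ × ℕ) :=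
  {p | (p.2 : ℤ) < pos (-((m12 : ℤ) - m11)) - pos (-((m12 : ℤ) - m11) - m21) ∧
       (p.1 : ℤ) + 2 * p.2 = (m11 : ℤ) + m21}

def D2set (m11 m12 m21 : ℕ) : Set (ℕ × ℕ) :=
  {p | pos (-((m12 : ℤ) - m11)) - pos (-((m12 : ℤ) - m11) - m21) ≤ (p.2 : ℤ) ∧
       (p.2 : ℤ) < m21 ∧ (p.1 : ℤ) + p.2 = Dbound m11 m12 m21}

def D3set (m11 m12 m21 : ℕ) : Set (ℕ × ℕ) :=
  {p | (m21 : ℤ) ≤ p.2 ∧ (p.2 : ℤ) ≤ m21 + |((m12 : ℤ) - m11) + m21| ∧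
       (p.1 : ℤ) + p.2 = Dbound m11 m12 m21}

def D4set (m11 m12 m21 : ℕ) : Set (ℕ × ℕ) :=
  {p | (m21 : ℤ) + |((m12 : ℤ) - m11) + m21| < (p.2 : ℤ) ∧
       2 * (p.1 : ℤ) + p.2 = (m11 : ℤ) + m12}


section MonomialIdeals

open Finsupp
open scoped Pointwise

variable {σ K : Type*}

theorem span_monomial_mul_span_monomial [CommSemiring K] (S T : Set (σ →₀ ℕ)) :
    Ideal.span ((fun e => monomial e (1 : K)) '' S) *
        Ideal.span ((fun e => monomial e (1 : K)) '' T) =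
      Ideal.span ((fun e => monomial e (1 : K)) '' (S + T)) := by
  rw [Ideal.span_mul_span']
  congr 1
  ext p
  simp only [Set.mem_mul, Set.mem_image, Set.mem_add]
  constructor
  · rintro ⟨_, ⟨s, hs, rfl⟩, _, ⟨t, ht, rfl⟩, rfl⟩
    exact ⟨s + t, ⟨s, hs, t, ht, rfl⟩, by simp [monomial_mul]⟩
  · rintro ⟨_, ⟨s, hs, t, ht, rfl⟩, rfl⟩
    exact ⟨_, ⟨s, hs, rfl⟩, _, ⟨t, ht, rfl⟩, by simp [monomial_mul]⟩

theorem span_X_pair_pow [CommSemiring K] {i j : σ} (hij : i ≠ j) (m : ℕ) :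
    (Ideal.span {X i, X j} : Ideal (MvPolynomial σ K)) ^ m =
      Ideal.span ((fun e => monomial e (1 : K)) '' {e | m ≤ e i + e j}) := by
  classical
  induction m with
  | zero =>
    rw [pow_zero, Ideal.one_eq_top, eq_comm, Ideal.eq_top_iff_one]
    exact Ideal.subset_span ⟨0, by simp, rfl⟩
  | succ m ih =>
    have hpair : ({X i, X j} : Set (MvPolynomial σ K)) =
        (fun e => monomial e (1 : K)) '' {single i 1, single j 1} := by
      rw [Set.image_pair]; rfl
    rw [pow_succ, ih, hpair, span_monomial_mul_span_monomial]
    congr 2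
    ext e
    simp only [Set.mem_add, Set.mem_ofPred_eq, Set.mem_insert_iff, Set.mem_singleton_iff]
    constructor
    · rintro ⟨s, hs, t, rfl | rfl, rfl⟩ <;> simp [hij, hij.symm] <;> omega
    · intro he
      by_cases hi : e i = 0
      · have hj : e j ≠ 0 := by omega
        refine ⟨e - single j 1, ?_, _, Or.inr rfl, sub_add_single_one_cancel hj⟩
        simp [hij.symm]; omega
      · refine ⟨e - single i 1, ?_, _, Or.inl rfl, sub_add_single_one_cancel hi⟩
        simp [hij]; omega

theorem mem_span_X_pair_pow [CommSemiring K] {i j : σ} (hij : i ≠ j) (m : ℕ)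
    (p : MvPolynomial σ K) :
    p ∈ (Ideal.span {X i, X j} : Ideal (MvPolynomial σ K)) ^ m ↔
      ∀ e ∈ p.support, m ≤ e i + e j := by
  rw [span_X_pair_pow hij, mem_ideal_span_monomial_image]
  refine forall₂_congr fun e _ => ⟨?_, fun h => ⟨e, h, le_rfl⟩⟩
  rintro ⟨s, hs, hse⟩
  have hi := hse i
  have hj := hse j
  simp only [Set.mem_ofPred_eq] at hs
  omega

theorem finrank_restrictSupport [Field K] (S : Set (σ →₀ ℕ)) :
    finrank K (restrictSupport K S) = S.ncard :=
  finrank_eq_nat_card_basis (basisRestrictSupport K S)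

end MonomialIdeals

theorem weight_w_eq_iff (e : Fin 4 →₀ ℕ) (a b : ℕ) :
    Finsupp.weight w e = (a, b) ↔ e 0 + e 1 = a ∧ e 2 + e 3 = b := by
  simp [Finsupp.weight_eq_sum, Fin.sum_univ_four, w, Prod.ext_iff]

theorem finite_setOf_weight_w_eq (a b : ℕ) :
    {e : Fin 4 →₀ ℕ | Finsupp.weight w e = (a, b)}.Finite := by
  refine (Set.finite_Iic (Finsupp.equivFunOnFinite.symm ![a, a, b, b])).subset fun e he => ?_
  obtain ⟨h0, h1⟩ := (weight_w_eq_iff e a b).1 he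
  intro i
  fin_cases i <;> simp <;> omega

theorem finrank_inf_comp (K : Type*) [Field K] (I : Ideal (MvPolynomial (Fin 4) K))
    (Q : Set (Fin 4 →₀ ℕ))
    (hI : ∀ p, p ∈ I ↔ ∀ e ∈ p.support, e ∈ Q) (a b : ℕ) :
    finrank K ↥(I.restrictScalars K ⊓ comp K a b) =
      (Q ∩ {e | Finsupp.weight w e = (a, b)}).ncard := by
  rw [← finrank_restrictSupport (K := K)]
  congr 2
  all_goals
    ext p
    simp only [Submodule.mem_inf, Submodule.restrictScalars_mem, hI, comp,
      mem_weightedHomogeneousSubmodule, mem_restrictSupport_iff, Set.subset_inter_iff,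
      IsWeightedHomogeneous]
    simp [Set.subset_def]

/-- Exponents of the monomials in `I_Z`. -/
def expIZ (m11 m12 m21 : ℕ) : Set (Fin 4 →₀ ℕ) :=
  {e | m11 ≤ e 0 + e 2 ∧ m12 ≤ e 0 + e 3 ∧ m21 ≤ e 1 + e 2}

/-- Exponents of the monomials in `𝔪 I_Z`. -/
def expMulIZ (m11 m12 m21 : ℕ) : Set (Fin 4 →₀ ℕ) :=
  {e | ∃ i, e i ≠ 0 ∧ e - Finsupp.single i 1 ∈ expIZ m11 m12 m21}

theorem expIZ_mono {m11 m12 m21 : ℕ} {s e : Fin 4 →₀ ℕ} (hs : s ∈ expIZ m11 m12 m21)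
    (hse : s ≤ e) : e ∈ expIZ m11 m12 m21 := by
  have h0 := hse 0
  have h1 := hse 1
  have h2 := hse 2
  have h3 := hse 3
  simp only [expIZ, Set.mem_ofPred_eq] at hs ⊢
  omega

theorem expMulIZ_subset (m11 m12 m21 : ℕ) : expMulIZ m11 m12 m21 ⊆ expIZ m11 m12 m21 :=
  fun _ ⟨_, _, h⟩ => expIZ_mono h tsub_le_self

theorem mem_IZ_iff (K : Type*) [Field K] (m11 m12 m21 : ℕ) (p : MvPolynomial (Fin 4) K) :
    p ∈ IZ K m11 m12 m21 ↔ ∀ e ∈ p.support, e ∈ expIZ m11 m12 m21 := by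
  rw [IZ, Ideal.mem_inf, Ideal.mem_inf, I11, I12, I21, mem_span_X_pair_pow (by decide),
    mem_span_X_pair_pow (by decide), mem_span_X_pair_pow (by decide)]
  simp only [expIZ, Set.mem_ofPred_eq]
  grind

theorem IZ_eq_span (K : Type*) [Field K] (m11 m12 m21 : ℕ) :
    IZ K m11 m12 m21 =
      Ideal.span ((fun e => monomial e (1 : K)) '' expIZ m11 m12 m21) := by
  ext p
  rw [mem_IZ_iff, mem_ideal_span_monomial_image]
  exact forall₂_congr fun e _ => ⟨fun h => ⟨e, h, le_rfl⟩, fun ⟨_, hs, hse⟩ => expIZ_mono hs hse⟩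

theorem mIdeal_eq_span (K : Type*) [Field K] :
    mIdeal K = Ideal.span ((fun e => monomial e (1 : K)) ''
      Set.range fun i : Fin 4 => Finsupp.single i 1) := by
  rw [mIdeal, ← Set.range_comp]
  congr 1
  ext p
  simp [Fin.exists_fin_succ, X, eq_comm]

open scoped Pointwise in
theorem mem_mIdeal_mul_IZ_iff (K : Type*) [Field K] (m11 m12 m21 : ℕ) (p : MvPolynomial (Fin 4) K) :
    p ∈ mIdeal K * IZ K m11 m12 m21 ↔ ∀ e ∈ p.support, e ∈ expMulIZ m11 m12 m21 := by
  rw [mIdeal_eq_span, IZ_eq_span, span_monomial_mul_span_monomial, mem_ideal_span_monomial_image]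
  refine forall₂_congr fun e _ => ⟨?_, ?_⟩
  · rintro ⟨_, ⟨_, ⟨i, rfl⟩, s, hs, rfl⟩, hse⟩
    have hi := hse i
    simp only [Finsupp.add_apply, Finsupp.single_eq_same] at hi
    exact ⟨i, by omega, expIZ_mono hs (le_tsub_of_add_le_left hse)⟩
  · rintro ⟨i, hi, h⟩
    exact ⟨_, ⟨_, ⟨i, rfl⟩, _, h, rfl⟩,
      ((add_comm _ _).trans (Finsupp.sub_add_single_one_cancel hi)).le⟩

/-- Exponents of bidegree `(a, b)` of the minimal monomial generators of `I_Z`. -/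
def expGens (m11 m12 m21 a b : ℕ) : Set (Fin 4 →₀ ℕ) :=
  (expIZ m11 m12 m21 \ expMulIZ m11 m12 m21) ∩ {e | Finsupp.weight w e = (a, b)}

theorem beta0_IZ_eq_ncard (K : Type*) [Field K] (m11 m12 m21 a b : ℕ) :
    beta0 K (IZ K m11 m12 m21) a b = (expGens m11 m12 m21 a b).ncard := by
  have hfin : ∀ Q : Set (Fin 4 →₀ ℕ), (Q ∩ {e | Finsupp.weight w e = (a, b)}).Finite :=
    fun Q => (finite_setOf_weight_w_eq a b).subset Set.inter_subset_right
  rw [beta0, finrank_inf_comp K _ _ (mem_IZ_iff K m11 m12 m21),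
    finrank_inf_comp K _ _ (mem_mIdeal_mul_IZ_iff K m11 m12 m21), expGens,
    Set.inter_sdiff_distrib_right, Set.cast_ncard_sdiff
      (Set.inter_subset_inter_left _ (expMulIZ_subset m11 m12 m21)) (hfin _)]

theorem mem_expGens_iff {m11 m12 m21 : ℕ} (h1 : m11 ≤ m21) (h2 : m21 ≤ m12) (a b : ℕ)
    (e : Fin 4 →₀ ℕ) :
    e ∈ expGens m11 m12 m21 a b ↔
      e 0 + e 1 = a ∧ e 2 + e 3 = b ∧ e 0 + e 3 = m12 ∧ e 1 + e 2 = m21 ∧ m11 ≤ e 0 + e 2 := by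
  simp only [expGens, expMulIZ, expIZ, Set.mem_inter_iff, Set.mem_sdiff, Set.mem_ofPred_eq,
    weight_w_eq_iff, Fin.exists_fin_succ, Finsupp.tsub_apply, Finsupp.single_apply]
  simp [Fin.ext_iff]
  omega

theorem image_expGens {m11 m12 m21 : ℕ} (h1 : m11 ≤ m21) (h2 : m21 ≤ m12) {a b : ℕ}
    (hab : a + b = m12 + m21) :
    (fun e : Fin 4 →₀ ℕ => (e 2 : ℤ)) '' expGens m11 m12 m21 a b =
      Finset.Icc (max (max 0 ((m21 : ℤ) - a)) (-(((a : ℤ) - m21 - m11) / 2)))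
        (min (m21 : ℤ) (m12 - a + m21)) := by
  ext n
  simp only [Set.mem_image, mem_expGens_iff h1 h2, Finset.coe_Icc, Set.mem_Icc]
  constructor
  · rintro ⟨e, he, rfl⟩
    omega
  · intro hn
    refine ⟨Finsupp.equivFunOnFinite.symm
      ![(n + a - m21).toNat, (m21 - n).toNat, n.toNat, (b - n).toNat], ?_, ?_⟩
    · simp
      omega
    · simp
      omega

theorem injOn_expGens {m11 m12 m21 : ℕ} (h1 : m11 ≤ m21) (h2 : m21 ≤ m12) (a b : ℕ) :
    Set.InjOn (fun e : Fin 4 →₀ ℕ => (e 2 : ℤ)) (expGens m11 m12 m21 a b) := by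
  intro e he f hf hef
  rw [mem_expGens_iff h1 h2] at he hf
  simp only at hef
  ext i
  fin_cases i <;> simp <;> omega

theorem phiNat_eq (t : ℕ) (n : ℤ) :
    phiNat t n = max 0 (min (t : ℤ) (n + 1) - (n + 1) / 2) := by
  induction t with
  | zero => simp only [phiNat]; omega
  | succ t ih =>
    cases t with
    | zero => simp only [phiNat]; split_ifs <;> omega
    | succ t =>
      simp only [phiNat, ih]
      split_ifs <;> push_cast <;> omega

theorem phi_eq {t : ℤ} (ht : 0 ≤ t) (n : ℤ) :
    phi t n = max 0 (min t (n + 1) - (n + 1) / 2) := by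
  rw [phi, phiNat_eq]
  split_ifs <;> omega

/-- Theorem 4.1 (first case `m₁₁ ≤ m₂₁`): the bigraded Betti numbers in homological
degree zero of `I_Z` for `Z = m₁₁P₁₁ + m₁₂P₁₂ + m₂₁P₂₁` with `0 ≤ m₁₁ ≤ m₂₁ ≤ m₁₂`. -/
theorem beta0_three_fat_points_case1 (m11 m12 m21 : ℕ)
    (h1 : m11 ≤ m21) (h2 : m21 ≤ m12) (a b : ℕ) :
    ((a : ℤ) + b = (m12 : ℤ) + m21 →
      beta0 k (IZ k m11 m12 m21) a b =
        pos (min (min (a : ℤ) ((b : ℤ) - m11)) ((m21 : ℤ) - m11) + 1) +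
          phi2 (m12 : ℤ) ((m12 : ℤ) - m11) b) ∧
    ((a : ℤ) + b ≠ (m12 : ℤ) + m21 → beta0 k (IZ k m11 m12 m21) a b = 0) := by
  rw [beta0_IZ_eq_ncard]
  constructor
  · intro hab
    rw [← (injOn_expGens h1 h2 a b).ncard_image,
      image_expGens h1 h2 (by exact_mod_cast hab), Set.ncard_coe_finset, Int.card_Icc, phi2,
      phi_eq (by omega), phi_eq (by omega), pos]
    omega
  · intro hab
    rw [Nat.cast_eq_zero]
    convert Set.ncard_empty (Fin 4 →₀ ℕ)
    refine Set.eq_empty_of_forall_notMem fun e he => hab ?_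
    rw [mem_expGens_iff h1 h2] at he
    omega

end
end

section
/- Let m_12, m_21 be nonnegative integers and let I_Z = (x_0,x_3)^{m_12} ∩ (x_1,x_2)^{m_21} be the ideal of the two non-collinear fat points Z = m_12 P_12 + m_21 P_21. Then for all integers i, j ≥ 0: dim_k (I_Z ∩ R_{(i,j)}) = Σ_{(a,b,c,d) ∈ 𝒟_0} (i − a − b + 1)_+ · (j − c − d + 1)_+ − Σ_{(a,b,c,d) ∈ 𝒟_1} (i − a − b + 1)_+ · (j − c − d + 1)_+ + Σ_{(a,b,c,d) ∈ 𝒟_2} (i − a − b + 1)_+ · (j − c − d + 1)_+. -/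
open MvPolynomial Module

noncomputable section

variable (k : Type*) [Field k] [CharZero k]

/-- The box `0 ≤ a, d ≤ m₁₂`, `0 ≤ b, c ≤ m₂₁` of quadruples `(a,b,c,d)`
(allowing the shifts by one needed in `𝒟₁, 𝒟₂`). -/
def quadBox (m12 m21 : ℕ) : Finset (ℕ × ℕ × ℕ × ℕ) :=
  (Finset.range (m12 + 1)) ×ˢ (Finset.range (m21 + 1)) ×ˢ
    (Finset.range (m21 + 1)) ×ˢ (Finset.range (m12 + 1))

/-- Membership in a power of an ideal generated by two variables, read off the support. -/
lemma mem_span_X_pair_pow_iff {σ : Type*} {R : Type*} [CommSemiring R] {u v : σ} (huv : u ≠ v)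
    (m : ℕ) (p : MvPolynomial σ R) :
    p ∈ (Ideal.span {X u, X v} : Ideal (MvPolynomial σ R)) ^ m ↔
      ∀ d ∈ p.support, m ≤ d u + d v := by
  classical
  constructor
  · induction m generalizing p with
    | zero => simp
    | succ m ih =>
      intro hp
      rw [pow_succ] at hp
      refine Submodule.mul_induction_on hp (fun r hr t ht d hd => ?_) (fun r t hr ht d hd => ?_)
      · obtain ⟨d₁, h₁, d₂, h₂, rfl⟩ := Finset.mem_add.1 (support_mul r t hd)
        have ht' : t ∈ Ideal.span ((X : σ → MvPolynomial σ R) '' {u, v}) := by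
          rwa [Set.image_pair]
        obtain ⟨x, hx, hx0⟩ := mem_ideal_span_X_image.1 ht' d₂ h₂
        have := ih r hr d₁ h₁
        rcases hx with rfl | rfl <;> simp only [Finsupp.add_apply] <;> omega
      · rcases Finset.mem_union.1 (support_add hd) with h | h
        exacts [hr d h, ht d h]
  · intro h
    rw [p.as_sum]
    refine Ideal.sum_mem _ fun d hd => ?_
    have hsplit : d = Finsupp.single u (d u) + Finsupp.single v (d v) +
        (d.erase u).erase v := by
      have hv : d v = d.erase u v := by rw [Finsupp.erase_ne huv.symm]
      rw [hv, add_assoc, Finsupp.single_add_erase, Finsupp.single_add_erase]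
    have hmon : monomial d (coeff d p) =
        X u ^ d u * X v ^ d v * monomial ((d.erase u).erase v) (coeff d p) := by
      rw [X_pow_eq_monomial, X_pow_eq_monomial, monomial_mul, monomial_mul, ← hsplit]
      simp
    rw [hmon]
    refine Ideal.mul_mem_right _ _ (Ideal.pow_le_pow_right (h d hd) ?_)
    rw [pow_add]
    exact Ideal.mul_mem_mul (Ideal.pow_mem_pow (Ideal.subset_span (by simp)) _)
      (Ideal.pow_mem_pow (Ideal.subset_span (by simp)) _)

/-- Exponents of the bidegree `(i, j)` monomials lying in the ideal of two fat points. -/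
def fatPointExponents (m12 m21 i j : ℕ) : Set (Fin 4 →₀ ℕ) :=
  {d | (m12 ≤ d 0 + d 3 ∧ m21 ≤ d 1 + d 2) ∧ d 0 + d 1 = i ∧ d 2 + d 3 = j}

lemma weight_w_apply (d : Fin 4 →₀ ℕ) :
    Finsupp.weight w d = (d 0 + d 1, d 2 + d 3) := by
  rw [Finsupp.weight_apply, Finsupp.sum_fintype _ _ (by simp)]
  simp [Fin.sum_univ_four, w, Prod.ext_iff]

lemma inf_comp_eq_restrictSupport (K : Type*) [Field K] (m12 m21 i j : ℕ) :
    (I12 K ^ m12 ⊓ I21 K ^ m21).restrictScalars K ⊓ comp K i j =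
      restrictSupport K (fatPointExponents m12 m21 i j) := by
  ext p
  simp only [Submodule.mem_inf, Submodule.restrictScalars_mem, I12, I21, comp,
    mem_span_X_pair_pow_iff (show (0 : Fin 4) ≠ 3 by decide),
    mem_span_X_pair_pow_iff (show (1 : Fin 4) ≠ 2 by decide),
    mem_weightedHomogeneousSubmodule, IsWeightedHomogeneous, weight_w_apply,
    mem_restrictSupport_iff, Set.subset_def, Finset.mem_coe, fatPointExponents,
    Set.mem_ofPred_eq, Prod.mk.injEq, ← MvPolynomial.mem_support_iff]
  constructor
  · rintro ⟨⟨h₁, h₂⟩, h₃⟩ d hd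
    exact ⟨⟨h₁ d hd, h₂ d hd⟩, h₃ hd⟩
  · intro h
    exact ⟨⟨fun d hd => (h d hd).1.1, fun d hd => (h d hd).1.2⟩, fun d hd => (h d hd).2⟩

lemma ncard_fatPointExponents (m12 m21 i j : ℕ) :
    (fatPointExponents m12 m21 i j).ncard =
      ((Finset.HasAntidiagonal.antidiagonal i ×ˢ
        Finset.HasAntidiagonal.antidiagonal j).filter
        (fun e => m12 ≤ e.1.1 + e.2.2 ∧ m21 ≤ e.1.2 + e.2.1)).card := by
  rw [← Set.ncard_coe_finset]
  refine Set.ncard_congr (fun d _ => ((d 0, d 1), (d 2, d 3))) ?_ ?_ ?_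
  · rintro d ⟨h, h'⟩
    simp [h, h']
  · intro d e _ _ h
    simp only [Prod.mk.injEq] at h
    ext x
    fin_cases x <;> simp [h]
  · rintro ⟨⟨a, b⟩, c, e⟩ h
    simp only [Finset.coe_filter, Finset.mem_product, Finset.HasAntidiagonal.mem_antidiagonal,
      Set.mem_ofPred_eq] at h
    refine ⟨Finsupp.equivFunOnFinite.symm ![a, b, c, e], ?_, ?_⟩ <;>
      simp [fatPointExponents, h]

lemma finrank_inf_comp_s16 (K : Type*) [Field K] (m12 m21 i j : ℕ) :
    finrank K ↥((I12 K ^ m12 ⊓ I21 K ^ m21).restrictScalars K ⊓ comp K i j) =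
      ((Finset.HasAntidiagonal.antidiagonal i ×ˢ
        Finset.HasAntidiagonal.antidiagonal j).filter
        (fun e => m12 ≤ e.1.1 + e.2.2 ∧ m21 ≤ e.1.2 + e.2.1)).card := by
  rw [inf_comp_eq_restrictSupport, finrank_eq_nat_card_basis (basisRestrictSupport K _),
    Nat.card_coe_set_eq, ncard_fatPointExponents]

lemma sum_range_telescope_le (s n : ℕ) (u : ℕ → ℤ) :
    ∑ a ∈ Finset.range (n + 1), (if a ≤ s then u a - (if a = 0 then 0 else u (a - 1)) else 0) =
      u (min s n) := by
  induction n with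
  | zero => simp
  | succ n ih =>
    rw [Finset.sum_range_succ, ih]
    by_cases h : n + 1 ≤ s
    · simp [h, show min s n = n by omega]
    · simp [h, show min s n = s by omega, show min s (n + 1) = s by omega]

/-- The sign with which a pair of exponents of sum `n` enters the resolution of `(x, y) ^ m`. -/
def koszulSign (m n : ℕ) : ℤ := (if n = m then 1 else 0) - (if n = m + 1 then 1 else 0)

/-- The Hilbert series of `(x, y) ^ m` from its resolution, one monomial at a time. -/
lemma sum_koszulSign (m s t : ℕ) :
    ∑ a ∈ Finset.range (m + 1), ∑ d ∈ Finset.range (m + 1),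
        koszulSign m (a + d) * (if a ≤ s ∧ d ≤ t then 1 else 0) =
      if m ≤ s + t then 1 else 0 := by
  have key : ∀ a ∈ Finset.range (m + 1),
      ∑ d ∈ Finset.range (m + 1), koszulSign m (a + d) * (if a ≤ s ∧ d ≤ t then 1 else 0) =
      if a ≤ s then (if m ≤ t + a then (1 : ℤ) else 0) -
        (if a = 0 then 0 else if m ≤ t + (a - 1) then 1 else 0) else 0 := by
    intro a ha
    have ha' : a ≤ m := Nat.lt_succ_iff.1 (Finset.mem_range.1 ha)
    have hterm : ∀ d ∈ Finset.range (m + 1),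
        koszulSign m (a + d) * (if a ≤ s ∧ d ≤ t then 1 else 0) =
        (if d = m - a then (if a ≤ s ∧ m - a ≤ t then (1 : ℤ) else 0) else 0) -
        (if d = m + 1 - a then (if a ≤ s ∧ m + 1 - a ≤ t then (1 : ℤ) else 0) else 0) := by
      intro d _
      unfold koszulSign
      split_ifs <;> omega
    rw [Finset.sum_congr rfl hterm, Finset.sum_sub_distrib, Finset.sum_ite_eq',
      Finset.sum_ite_eq']
    simp only [Finset.mem_range]
    split_ifs <;> omega
  rw [Finset.sum_congr rfl key,
    sum_range_telescope_le s m (fun a => if m ≤ t + a then (1 : ℤ) else 0)]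
  split_ifs <;> omega

lemma pos_eq_sum_antidiagonal (i a b : ℕ) :
    pos ((i : ℤ) - a - b + 1) =
      ∑ p ∈ Finset.HasAntidiagonal.antidiagonal i, if a ≤ p.1 ∧ b ≤ p.2 then (1 : ℤ) else 0 := by
  rw [Finset.Nat.sum_antidiagonal_eq_sum_range_succ_mk, ← Finset.sum_filter, Finset.sum_const]
  have : (Finset.range i.succ).filter (fun x => a ≤ x ∧ b ≤ i - x) =
      Finset.Ico a (i + 1 - b) := by
    ext x
    simp only [Finset.mem_filter, Finset.mem_range, Finset.mem_Ico]
    omega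
  rw [this, Nat.card_Ico]
  simp only [pos, nsmul_eq_mul, mul_one]
  omega

lemma alternating_sum_eq_sum_koszulSign (m12 m21 : ℕ) (f : ℕ × ℕ × ℕ × ℕ → ℤ) :
    (∑ q ∈ (quadBox m12 m21).filter
          (fun q => q.1 + q.2.2.2 = m12 ∧ q.2.1 + q.2.2.1 = m21), f q) -
      (∑ q ∈ (quadBox m12 m21).filter
          (fun q => (q.1 + q.2.2.2 = m12 + 1 ∧ q.2.1 + q.2.2.1 = m21) ∨
            (q.1 + q.2.2.2 = m12 ∧ q.2.1 + q.2.2.1 = m21 + 1)), f q) +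
      ∑ q ∈ (quadBox m12 m21).filter
          (fun q => q.1 + q.2.2.2 = m12 + 1 ∧ q.2.1 + q.2.2.1 = m21 + 1), f q =
    ∑ q ∈ quadBox m12 m21,
      koszulSign m12 (q.1 + q.2.2.2) * koszulSign m21 (q.2.1 + q.2.2.1) * f q := by
  rw [Finset.sum_filter, Finset.sum_filter, Finset.sum_filter, ← Finset.sum_sub_distrib,
    ← Finset.sum_add_distrib]
  refine Finset.sum_congr rfl fun q _ => ?_
  unfold koszulSign
  split_ifs <;> omega

lemma sum_quadBox (m12 m21 : ℕ) (p q : ℕ × ℕ) :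
    ∑ x ∈ quadBox m12 m21, koszulSign m12 (x.1 + x.2.2.2) * koszulSign m21 (x.2.1 + x.2.2.1) *
        ((if x.1 ≤ p.1 ∧ x.2.1 ≤ p.2 then 1 else 0) *
          (if x.2.2.1 ≤ q.1 ∧ x.2.2.2 ≤ q.2 then 1 else 0)) =
      if m12 ≤ p.1 + q.2 ∧ m21 ≤ p.2 + q.1 then 1 else 0 := by
  have hprod : (if m12 ≤ p.1 + q.2 ∧ m21 ≤ p.2 + q.1 then (1 : ℤ) else 0) =
      (if m12 ≤ p.1 + q.2 then 1 else 0) * (if m21 ≤ p.2 + q.1 then 1 else 0) := by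
    split_ifs <;> simp_all
  rw [hprod, ← sum_koszulSign, ← sum_koszulSign, Finset.sum_mul, quadBox, Finset.sum_product]
  refine Finset.sum_congr rfl fun a _ => ?_
  rw [Finset.sum_mul_sum, Finset.sum_comm, Finset.sum_product]
  refine Finset.sum_congr rfl fun b _ => ?_
  rw [Finset.sum_product_right]
  simp_rw [Finset.mul_sum]
  refine Finset.sum_congr rfl fun d _ => Finset.sum_congr rfl fun c _ => ?_
  split_ifs <;> first | omega | simp

/-- Lemma 3.4 (Hilbert-function form): dimension of the bidegree-`(i,j)` component of the
ideal of two non-collinear fat points, computed from its minimal free resolution via the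
sets `𝒟₀, 𝒟₁, 𝒟₂` of quadruples. -/
theorem dim_two_noncollinear_fat_points (m12 m21 : ℕ) (i j : ℕ) :
    (finrank k ↥((I12 k ^ m12 ⊓ I21 k ^ m21).restrictScalars k ⊓ comp k i j) : ℤ) =
      (∑ q ∈ (quadBox m12 m21).filter
          (fun q => q.1 + q.2.2.2 = m12 ∧ q.2.1 + q.2.2.1 = m21),
        pos ((i : ℤ) - q.1 - q.2.1 + 1) * pos ((j : ℤ) - q.2.2.1 - q.2.2.2 + 1)) -
      (∑ q ∈ (quadBox m12 m21).filter
          (fun q => (q.1 + q.2.2.2 = m12 + 1 ∧ q.2.1 + q.2.2.1 = m21) ∨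
            (q.1 + q.2.2.2 = m12 ∧ q.2.1 + q.2.2.1 = m21 + 1)),
        pos ((i : ℤ) - q.1 - q.2.1 + 1) * pos ((j : ℤ) - q.2.2.1 - q.2.2.2 + 1)) +
      ∑ q ∈ (quadBox m12 m21).filter
          (fun q => q.1 + q.2.2.2 = m12 + 1 ∧ q.2.1 + q.2.2.1 = m21 + 1),
        pos ((i : ℤ) - q.1 - q.2.1 + 1) * pos ((j : ℤ) - q.2.2.1 - q.2.2.2 + 1) := by
  rw [finrank_inf_comp_s16, alternating_sum_eq_sum_koszulSign]
  simp_rw [pos_eq_sum_antidiagonal, Finset.sum_mul_sum, Finset.mul_sum]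
  rw [Finset.sum_comm]
  simp_rw [Finset.sum_comm (s := quadBox m12 m21), sum_quadBox]
  rw [Finset.card_filter, Finset.sum_product]
  push_cast
  rfl

end
end
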